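/- Let n ≥ 2, let L = ℤ^n and Φ be the root system of type B_n with Weyl group W. Then for every w ∈ W one has k_4(L,w) = n − l(w); equivalently, every w ∈ W has a reduced presentation whose subroot lattice L_1 is a primitive sublattice of ℤ^n, i.e. ℤ^n/L_1 is torsion-free. -/

import Mathlib

/-- The standard basis vector `e i` of `ℤ^m`. -/
def std (m : ℕ) (i : Fin m) : Fin m → ℤ := Pi.single i 1

/-- The root system of type `B_n`:
`{± e_i} ∪ {± e_i ± e_j | i < j}` in `ℤ^n`. -/
def PhiB (n : ℕ) : Set (Fin n → ℤ) :=
  {v | ∃ i : Fin n, v = std n i ∨ v = -std n i} ∪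
  {v | ∃ i j : Fin n, i ≠ j ∧
    (v = std n i - std n j ∨ v = std n i + std n j ∨ v = -(std n i + std n j))}

/-- The graph `G(A)` associated to a set `A` of roots of type `B_n`: vertices `1, …, n`,
with `i ≠ j` adjacent iff one of the roots `±(e_i - e_j)`, `±(e_i + e_j)` lies in `A`. -/
def GB (n : ℕ) (A : Set (Fin n → ℤ)) : SimpleGraph (Fin n) where
  Adj i j := i ≠ j ∧
    (std n i - std n j ∈ A ∨ std n j - std n i ∈ A ∨
     std n i + std n j ∈ A ∨ -(std n i + std n j) ∈ A)
  symm := by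
    refine ⟨?_⟩
    rintro i j ⟨h1, h2⟩
    refine ⟨h1.symm, ?_⟩
    rcases h2 with h | h | h | h
    · exact Or.inr (Or.inl h)
    · exact Or.inl h
    · refine Or.inr (Or.inr (Or.inl ?_)); rwa [add_comm]
    · refine Or.inr (Or.inr (Or.inr ?_)); rwa [add_comm]
  loopless := ⟨fun i h => h.1 rfl⟩

/-- The standard scalar product on `ℤ^m`. -/
def dotZ {m : ℕ} (x y : Fin m → ℤ) : ℤ := ∑ i, x i * y i

/-- The reflection `s_α : x ↦ x - (2(x,α)/(α,α)) • α` (the division is exact for every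
root `α` of the systems considered here, so this is the honest reflection). -/
def reflZ {m : ℕ} (α : Fin m → ℤ) (x : Fin m → ℤ) : Fin m → ℤ :=
  x - ((2 * dotZ x α) / dotZ α α) • α

/-- The signed permutation determined by `σ` and signs `ε`, i.e. the ℤ-linear map with
`w(e_i) = ε_i • e_{σ(i)}`. -/
def wSigned {n : ℕ} (σ : Equiv.Perm (Fin n)) (ε : Fin n → ℤ) :
    (Fin n → ℤ) → (Fin n → ℤ) :=
  fun x j => ε (σ⁻¹ j) * x (σ⁻¹ j)

/-- `(α_1, …, α_k)` is a presentation of `w`: all `α_i` are roots and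
`w = s_{α_1} ∘ ⋯ ∘ s_{α_k}`. -/
def IsPresZ {m : ℕ} (Φ : Set (Fin m → ℤ)) (w : (Fin m → ℤ) → (Fin m → ℤ))
    (l : List (Fin m → ℤ)) : Prop :=
  (∀ α ∈ l, α ∈ Φ) ∧ l.foldr (fun α f => reflZ α ∘ f) id = w

/-- The length `l(w)`: the minimal length of a presentation of `w`. -/
noncomputable def clen {m : ℕ} (Φ : Set (Fin m → ℤ))
    (w : (Fin m → ℤ) → (Fin m → ℤ)) : ℕ :=
  sInf {k | ∃ l, IsPresZ Φ w l ∧ l.length = k}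

/-- `k₂(L, L₁)` for `L = ℤ^m`: the minimal `k` such that there exist roots
`α_1, …, α_k ∈ Φ` with `L₁ + Σ ℤ α_i = ℤ^m`. -/
noncomputable def k2z {m : ℕ} (Φ : Set (Fin m → ℤ)) (L1 : Submodule ℤ (Fin m → ℤ)) : ℕ :=
  sInf {k | ∃ f : Fin k → (Fin m → ℤ), (∀ i, f i ∈ Φ) ∧
    L1 ⊔ Submodule.span ℤ (Set.range f) = ⊤}

/-- `k₄(L, w)`: the minimum of `k₂(L, L₁)` over the subroot lattices `L₁` of all
reduced presentations of `w`. -/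
noncomputable def k4z {m : ℕ} (Φ : Set (Fin m → ℤ))
    (w : (Fin m → ℤ) → (Fin m → ℤ)) : ℕ :=
  sInf {c | ∃ l, IsPresZ Φ w l ∧ l.length = clen Φ w ∧
    k2z Φ (Submodule.span ℤ {α | α ∈ l}) = c}

theorem dotZ_std {n : ℕ} (x : Fin n → ℤ) (i : Fin n) : dotZ x (std n i) = x i := by
  simp [dotZ, std, Pi.single_apply]

theorem dotZ_add {n : ℕ} (x y z : Fin n → ℤ) : dotZ x (y + z) = dotZ x y + dotZ x z := by
  simp [dotZ, mul_add, Finset.sum_add_distrib]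

theorem dotZ_smul {n : ℕ} (x y : Fin n → ℤ) (c : ℤ) : dotZ x (c • y) = c * dotZ x y := by
  simp only [dotZ, Pi.smul_apply, smul_eq_mul, Finset.mul_sum]
  exact Finset.sum_congr rfl fun _ _ => by ring

theorem std_apply {n : ℕ} (i k : Fin n) : std n i k = if k = i then 1 else 0 := by
  simp [std, Pi.single_apply]

/-- A reflection in a short root. -/
theorem reflZ_short {n : ℕ} (i : Fin n) (a : ℤ) (ha : a * a = 1) (x : Fin n → ℤ) :
    reflZ (a • std n i) x = x - (2 * a * x i) • (a • std n i) := by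
  have h : dotZ (a • std n i) (a • std n i) = 1 := by
    rw [dotZ_smul, dotZ_std]; simp [std_apply, ha]
  rw [reflZ, h, Int.ediv_one, dotZ_smul, dotZ_std, mul_assoc]

/-- A reflection in a long root. -/
theorem reflZ_long {n : ℕ} (i j : Fin n) (hij : i ≠ j) (a b : ℤ) (ha : a * a = 1)
    (hb : b * b = 1) (x : Fin n → ℤ) :
    reflZ (a • std n i + b • std n j) x
      = x - (a * x i + b * x j) • (a • std n i + b • std n j) := by
  have h : dotZ (a • std n i + b • std n j) (a • std n i + b • std n j) = 2 := by
    rw [dotZ_add, dotZ_smul, dotZ_smul, dotZ_std, dotZ_std]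
    simp [std_apply, hij, hij.symm, ha, hb]
  rw [reflZ, h, dotZ_add, dotZ_smul, dotZ_smul, dotZ_std, dotZ_std,
    Int.mul_ediv_cancel_left _ (by norm_num)]

theorem reflZ_short_eq {n : ℕ} (i : Fin n) (a : ℤ) (ha : a * a = 1) :
    reflZ (a • std n i) = wSigned 1 (fun k => if k = i then -1 else 1) := by
  funext x k
  rw [reflZ_short i a ha]
  simp only [Pi.sub_apply, Pi.smul_apply, std_apply, smul_eq_mul, wSigned, inv_one,
    Equiv.Perm.one_apply]
  split_ifs with h
  · subst h; linear_combination (-2 * x k) * ha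
  · ring

theorem reflZ_long_eq {n : ℕ} (i j : Fin n) (hij : i ≠ j) (a b : ℤ) (ha : a * a = 1)
    (hb : b * b = 1) :
    reflZ (a • std n i + b • std n j)
      = wSigned (Equiv.swap i j) (fun k => if k = i ∨ k = j then -(a * b) else 1) := by
  funext x k
  rw [reflZ_long i j hij a b ha hb]
  simp only [Pi.sub_apply, Pi.smul_apply, Pi.add_apply, std_apply, smul_eq_mul, wSigned,
    Equiv.swap_inv]
  by_cases h : k = i
  · subst h
    simp [hij]
    linear_combination (- x k) * ha
  · by_cases h' : k = j
    · subst h'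
      simp [hij.symm]
      linear_combination (- x k) * hb
    · simp [Equiv.swap_apply_of_ne_of_ne h h', h, h']

theorem wSigned_comp {n : ℕ} (σ τ : Equiv.Perm (Fin n)) (ε δ : Fin n → ℤ) :
    wSigned σ ε ∘ wSigned τ δ = wSigned (σ * τ) (fun k => ε (τ k) * δ k) := by
  funext x k
  simp [wSigned, mul_assoc]

theorem root_cases {n : ℕ} {α : Fin n → ℤ} (h : α ∈ PhiB n) :
    (∃ i, ∃ a : ℤ, a * a = 1 ∧ α = a • std n i) ∨
    (∃ i j, ∃ a b : ℤ, i ≠ j ∧ a * a = 1 ∧ b * b = 1 ∧ α = a • std n i + b • std n j) := by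
  rcases h with ⟨i, h | h⟩ | ⟨i, j, hij, h | h | h⟩
  · exact Or.inl ⟨i, 1, by norm_num, by simp [h]⟩
  · exact Or.inl ⟨i, -1, by norm_num, by simp [h]⟩
  · exact Or.inr ⟨i, j, 1, -1, hij, by norm_num, by norm_num, by rw [h]; module⟩
  · exact Or.inr ⟨i, j, 1, 1, hij, by norm_num, by norm_num, by rw [h]; module⟩
  · exact Or.inr ⟨i, j, -1, -1, hij, by norm_num, by norm_num, by rw [h]; module⟩

theorem std_mem {n : ℕ} (i : Fin n) : std n i ∈ PhiB n := Or.inl ⟨i, Or.inl rfl⟩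

theorem long_mem {n : ℕ} (i j : Fin n) (hij : i ≠ j) (b : ℤ) (hb : b * b = 1) :
    (1 : ℤ) • std n i + b • std n j ∈ PhiB n := by
  rcases mul_self_eq_one_iff.1 hb with rfl | rfl
  · exact Or.inr ⟨i, j, hij, Or.inr (Or.inl (by module))⟩
  · exact Or.inr ⟨i, j, hij, Or.inl (by module)⟩

theorem reflZ_root_signed {n : ℕ} {α : Fin n → ℤ} (h : α ∈ PhiB n) :
    ∃ σ ε, (∀ k, ε k * ε k = 1) ∧ reflZ α = wSigned σ ε := by
  rcases root_cases h with ⟨i, a, ha, rfl⟩ | ⟨i, j, a, b, hij, ha, hb, rfl⟩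
  · refine ⟨_, _, ?_, reflZ_short_eq i a ha⟩
    intro k; split_ifs <;> norm_num
  · refine ⟨_, _, ?_, reflZ_long_eq i j hij a b ha hb⟩
    intro k; split_ifs
    · linear_combination b * b * ha + hb
    · norm_num

theorem pres_signed {n : ℕ} (l : List (Fin n → ℤ)) (h : ∀ α ∈ l, α ∈ PhiB n) :
    ∃ σ ε, (∀ k, ε k * ε k = 1) ∧ l.foldr (fun α f => reflZ α ∘ f) id = wSigned σ ε := by
  induction l with
  | nil => exact ⟨1, fun _ => 1, by simp, by funext x k; simp [wSigned]⟩
  | cons α l ih =>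
    obtain ⟨τ, δ, hδ, h2⟩ := ih fun β hβ => h β (List.mem_cons_of_mem _ hβ)
    obtain ⟨σ, ε, hε, h1⟩ := reflZ_root_signed (h α List.mem_cons_self)
    refine ⟨_, _, ?_, by rw [List.foldr_cons, h1, h2, wSigned_comp]⟩
    intro k
    linear_combination (δ k * δ k) * hε (τ k) + hδ k

/-- For a root, the reflection is `x - c α` with `c = 0` iff `x ⟂ α`. -/
theorem reflZ_root {n : ℕ} {α : Fin n → ℤ} (h : α ∈ PhiB n) (x : Fin n → ℤ) :
    ∃ c : ℤ, reflZ α x = x - c • α ∧ (c = 0 ↔ dotZ x α = 0) := by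
  rcases root_cases h with ⟨i, a, ha, rfl⟩ | ⟨i, j, a, b, hij, ha, hb, rfl⟩
  · refine ⟨_, reflZ_short i a ha x, ?_⟩
    rw [dotZ_smul, dotZ_std]
    constructor <;> intro h <;> linarith
  · refine ⟨_, reflZ_long i j hij a b ha hb x, ?_⟩
    rw [dotZ_add, dotZ_smul, dotZ_smul, dotZ_std, dotZ_std]

theorem reflZ_invol {n : ℕ} {α : Fin n → ℤ} (h : α ∈ PhiB n) : reflZ α ∘ reflZ α = id := by
  funext x
  rcases root_cases h with ⟨i, a, ha, rfl⟩ | ⟨i, j, a, b, hij, ha, hb, rfl⟩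
  · simp only [Function.comp, reflZ_short i a ha, id]
    simp only [Pi.sub_apply, Pi.smul_apply, std_apply, smul_eq_mul, if_true]
    funext k
    simp only [Pi.sub_apply, Pi.smul_apply, std_apply, smul_eq_mul]
    split_ifs
    · linear_combination (4 * a * a * x i) * ha
    · ring
  · simp only [Function.comp, reflZ_long i j hij a b ha hb, id]
    funext k
    simp only [Pi.sub_apply, Pi.add_apply, Pi.smul_apply, std_apply, smul_eq_mul, if_true,
      hij, hij.symm, if_false]
    linear_combination ((a * x i + b * x j) * (a * (if k = i then 1 else 0) +
      b * (if k = j then 1 else 0))) * (ha + hb)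

theorem span_supp {n : ℕ} (l : List (Fin n → ℤ)) (i : Fin n) (h : ∀ α ∈ l, α i = 0)
    (v : Fin n → ℤ) (hv : v ∈ Submodule.span ℤ {α | α ∈ l}) : v i = 0 := by
  induction hv using Submodule.span_induction with
  | mem x hx => exact h x hx
  | zero => rfl
  | add x y _ _ hx hy => simp [hx, hy]
  | smul c x _ hx => simp [hx]

theorem mem_span_cons {n : ℕ} (a : Fin n → ℤ) (l : List (Fin n → ℤ)) (v : Fin n → ℤ) :
    v ∈ Submodule.span ℤ {α | α ∈ a :: l} ↔
      ∃ c : ℤ, ∃ u ∈ Submodule.span ℤ {α | α ∈ l}, v = c • a + u := by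
  have : {α | α ∈ a :: l} = insert a {α | α ∈ l} := by ext; simp
  rw [this, Submodule.mem_span_insert]

/-- Main construction. -/
theorem construct {n : ℕ} (S : Finset (Fin n)) : ∀ (σ : Equiv.Perm (Fin n)) (ε : Fin n → ℤ),
    (∀ k, ε k * ε k = 1) → (∀ k, k ∉ S → σ k = k ∧ ε k = 1) →
    ∃ l r : List (Fin n → ℤ), IsPresZ (PhiB n) (wSigned σ ε) l ∧ (∀ α ∈ r, α ∈ PhiB n) ∧
      (∀ α ∈ l, ∀ k, k ∉ S → α k = 0) ∧
      (∀ x, wSigned σ ε x = x → ∀ α ∈ l, dotZ x α = 0) ∧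
      l.length + r.length = S.card ∧
      (∀ i ∈ S, std n i ∈ Submodule.span ℤ {α | α ∈ l} ⊔ Submodule.span ℤ {α | α ∈ r}) ∧
      (∀ (m : ℤ) (v : Fin n → ℤ), m ≠ 0 → m • v ∈ Submodule.span ℤ {α | α ∈ l} →
        v ∈ Submodule.span ℤ {α | α ∈ l}) := by
  induction S using Finset.induction_on with
  | empty =>
    intro σ ε hε hS
    refine ⟨[], [], ⟨by simp, ?_⟩, by simp, by simp, by simp, by simp, by simp, ?_⟩
    · have h1 : σ = 1 := by ext k; simp [(hS k (by simp)).1]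
      funext x k
      subst h1
      simp [wSigned, (hS k (by simp)).2]
    · intro m v hm hv
      simp only [List.not_mem_nil, Set.ofPred_false, Submodule.span_empty,
        Submodule.mem_bot] at hv ⊢
      exact (smul_eq_zero.1 hv).resolve_left hm
  | insert i S hi ih =>
    intro σ ε hε hS
    by_cases hfix : σ i = i ∧ ε i = 1
    · obtain ⟨l, r, hl, hr, hsupp, horth, hlen, hspan, htf⟩ := ih σ ε hε (by
        intro k hk
        by_cases hki : k = i
        · rw [hki]; exact hfix
        · exact hS k (by simp [hki, hk]))
      refine ⟨l, std n i :: r, hl, ?_, ?_, horth, ?_, ?_, htf⟩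
      · intro α hα
        rcases List.mem_cons.1 hα with rfl | hα
        · exact std_mem i
        · exact hr α hα
      · intro α hα k hk
        exact hsupp α hα k fun h => hk (Finset.mem_insert_of_mem h)
      · rw [Finset.card_insert_of_notMem hi, List.length_cons]; omega
      · intro j hj
        rcases Finset.mem_insert.1 hj with rfl | hj
        · exact Submodule.mem_sup_right (Submodule.subset_span (by simp))
        · have hle : Submodule.span ℤ {α | α ∈ l} ⊔ Submodule.span ℤ {α | α ∈ r} ≤
              Submodule.span ℤ {α | α ∈ l} ⊔ Submodule.span ℤ {α | α ∈ std n i :: r} :=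
            sup_le_sup le_rfl (Submodule.span_mono fun x hx => List.mem_cons_of_mem _ hx)
          exact hle (hspan j hj)
    · -- choose the root
      obtain ⟨α, hα, hαi, hαS, hαm, σ', ε', hε', hw', hS'⟩ : ∃ α ∈ PhiB n, α i = 1 ∧
          (∀ k, k ∉ insert i S → α k = 0) ∧
          (α - std n i ∈ Submodule.span ℤ {v | ∃ j ∈ S, v = std n j}) ∧
          ∃ σ' ε', (∀ k, ε' k * ε' k = 1) ∧ reflZ α ∘ wSigned σ ε = wSigned σ' ε' ∧
            ∀ k, k ∉ S → σ' k = k ∧ ε' k = 1 := by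
        by_cases hj : σ i = i
        · have hεi : ε i = -1 := by
            rcases mul_self_eq_one_iff.1 (hε i) with h | h
            · exact absurd ⟨hj, h⟩ hfix
            · exact h
          refine ⟨std n i, std_mem i, by simp [std_apply], ?_, by simp, 1 * σ,
            fun k => (if σ k = i then -1 else 1) * ε k, ?_, ?_, ?_⟩
          rotate_left 2
          · have := reflZ_short_eq i 1 (by norm_num)
            rw [one_smul] at this
            rw [this, wSigned_comp]
          · intro k hk
            by_cases hki : k = i
            · subst hki; simp [hj, hεi]
            · have := hS k (by simp [hki, hk])
              simp [this, hki]
          · intro k hk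
            simp only [Finset.mem_insert, not_or] at hk
            simp [std_apply, hk.1]
          · intro k
            dsimp only
            split_ifs
            · linear_combination hε k
            · linear_combination hε k
        · have hjS : σ i ∈ S := by
            by_contra hjS
            have := hS (σ i) (by simp [hj, hjS])
            exact hj (σ.injective this.1)
          have hb : (-ε i) * (-ε i) = 1 := by linear_combination hε i
          refine ⟨(1 : ℤ) • std n i + (-ε i) • std n (σ i), long_mem i _ (Ne.symm hj) _ hb,
            by simp [std_apply, Ne.symm hj], ?_, ?_, Equiv.swap i (σ i) * σ,
            fun k => (if σ k = i ∨ σ k = σ i then -(1 * -ε i) else 1) * ε k, ?_, ?_, ?_⟩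
          rotate_left 3
          · rw [reflZ_long_eq i (σ i) (Ne.symm hj) 1 _ (by norm_num) hb, wSigned_comp]
          · intro k hk
            by_cases hki : k = i
            · subst hki; simp [hε k]
            · have := hS k (by simp [hki, hk])
              have hkj : k ≠ σ i := fun h => hk (h ▸ hjS)
              simp [this, hki, hkj, Equiv.swap_apply_of_ne_of_ne hki hkj]
          · intro k hk
            simp only [Finset.mem_insert, not_or] at hk
            have hkj : k ≠ σ i := fun h => hk.2 (h ▸ hjS)
            simp [std_apply, hk.1, hkj]
          · have : (1 : ℤ) • std n i + (-ε i) • std n (σ i) - std n i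
                = (-ε i) • std n (σ i) := by module
            rw [this]
            exact Submodule.smul_mem _ _ (Submodule.subset_span ⟨_, hjS, rfl⟩)
          · intro k
            dsimp only
            split_ifs
            · linear_combination (ε i * ε i) * hε k + hε i
            · linear_combination hε k
      obtain ⟨l, r, hl, hr, hsupp, horth, hlen, hspan, htf⟩ := ih σ' ε' hε' hS'
      have hwc : wSigned σ ε = reflZ α ∘ wSigned σ' ε' := by
        rw [← hw', ← Function.comp_assoc, reflZ_invol hα, Function.id_comp]
      refine ⟨α :: l, r, ⟨?_, ?_⟩, hr, ?_, ?_, ?_, ?_, ?_⟩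
      · intro β hβ
        rcases List.mem_cons.1 hβ with rfl | hβ
        · exact hα
        · exact hl.1 β hβ
      · rw [List.foldr_cons, hl.2, hwc]
      · intro β hβ k hk
        rcases List.mem_cons.1 hβ with rfl | hβ
        · exact hαS k hk
        · exact hsupp β hβ k fun h => hk (Finset.mem_insert_of_mem h)
      · intro x hx
        obtain ⟨c, hc, hc0⟩ := reflZ_root hα x
        have h1 : wSigned σ' ε' x = reflZ α x := by
          rw [← hw', Function.comp_apply, hx]
        have h2 : wSigned σ' ε' x i = x i := by
          have h3 : σ'⁻¹ i = i := by
            rw [Equiv.Perm.inv_eq_iff_eq]; exact (hS' i hi).1.symm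
          simp [wSigned, h3, (hS' i hi).2]
        have hc00 : c = 0 := by
          rw [h1, hc] at h2
          simpa [hαi] using h2
        intro β hβ
        rcases List.mem_cons.1 hβ with rfl | hβ
        · exact hc0.1 hc00
        · refine horth x ?_ β hβ
          rw [h1, hc, hc00]; simp
      · rw [Finset.card_insert_of_notMem hi, List.length_cons]; omega
      · have hle : Submodule.span ℤ {α | α ∈ l} ⊔ Submodule.span ℤ {α | α ∈ r} ≤
            Submodule.span ℤ {β | β ∈ α :: l} ⊔ Submodule.span ℤ {α | α ∈ r} :=
          sup_le_sup (Submodule.span_mono fun x hx => List.mem_cons_of_mem _ hx) le_rfl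
        intro j hj
        rcases Finset.mem_insert.1 hj with rfl | hj
        · have h1 : α - std n j ∈ Submodule.span ℤ {β | β ∈ α :: l} ⊔
              Submodule.span ℤ {α | α ∈ r} := by
            refine (Submodule.span_le.2 ?_ : Submodule.span ℤ {v | ∃ j ∈ S, v = std n j} ≤ _) hαm
            rintro v ⟨k, hk, rfl⟩
            exact hle (hspan k hk)
          have h2 : α ∈ Submodule.span ℤ {β | β ∈ α :: l} ⊔ Submodule.span ℤ {α | α ∈ r} :=
            Submodule.mem_sup_left (Submodule.subset_span (by simp))
          simpa using Submodule.sub_mem _ h2 h1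
        · exact hle (hspan j hj)
      · intro m v hm hv
        obtain ⟨c, u, hu, huv⟩ := (mem_span_cons _ _ _).1 hv
        have hui : u i = 0 := span_supp l i (fun β hβ => hsupp β hβ i hi) u hu
        have hci : m * v i = c := by
          have := congrFun huv i
          simpa [hui, hαi] using this
        refine (mem_span_cons _ _ _).2 ⟨v i, v - v i • α, htf m _ hm ?_, by module⟩
        have : m • (v - v i • α) = u := by
          rw [smul_sub, huv, ← hci]; module
        rw [this]; exact hu

theorem exists_orth {n : ℕ} (L : List (Fin n → ℤ)) (h : L.length < n) :
    ∃ x : Fin n → ℤ, x ≠ 0 ∧ ∀ α ∈ L, dotZ x α = 0 := by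
  let f : (Fin n → ℤ) →ₗ[ℤ] (Fin L.length → ℤ) :=
    { toFun := fun x k => dotZ (L.get k) x
      map_add' := fun x y => by funext k; exact dotZ_add _ _ _
      map_smul' := fun c x => by funext k; exact dotZ_smul _ _ _ }
  have hf : ¬ Function.Injective f := fun hf => by
    have := le_of_fin_injective ℤ f hf
    omega
  rw [← LinearMap.ker_eq_bot, Submodule.eq_bot_iff] at hf
  push Not at hf
  obtain ⟨x, hx, hx0⟩ := hf
  refine ⟨x, hx0, fun α hα => ?_⟩
  obtain ⟨k, rfl⟩ := List.get_of_mem hα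
  have h1 : dotZ (L.get k) x = 0 := congrFun (LinearMap.mem_ker.1 hx) k
  rw [← h1]
  simp [dotZ, mul_comm]

theorem orth_top {n : ℕ} (x : Fin n → ℤ) (A B : Set (Fin n → ℤ))
    (hA : ∀ α ∈ A, dotZ x α = 0) (hB : ∀ α ∈ B, dotZ x α = 0)
    (h : ∀ i, std n i ∈ Submodule.span ℤ A ⊔ Submodule.span ℤ B) : x = 0 := by
  funext i
  have h1 := h i
  rw [← Submodule.span_union] at h1
  have key : ∀ v ∈ Submodule.span ℤ (A ∪ B), dotZ x v = 0 := by
    intro v hv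
    induction hv using Submodule.span_induction with
    | mem y hy => exact hy.elim (hA y) (hB y)
    | zero => simp [dotZ]
    | add y z _ _ hy hz => rw [dotZ_add, hy, hz, add_zero]
    | smul c y _ hy => rw [dotZ_smul, hy, mul_zero]
  have := key _ h1
  rwa [dotZ_std] at this

theorem pres_fix {n : ℕ} (l : List (Fin n → ℤ)) (x : Fin n → ℤ) (h : ∀ α ∈ l, dotZ x α = 0) :
    l.foldr (fun α f => reflZ α ∘ f) id x = x := by
  induction l with
  | nil => rfl
  | cons α l ih =>
    rw [List.foldr_cons, Function.comp_apply, ih fun β hβ => h β (List.mem_cons_of_mem _ hβ)]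
    simp [reflZ, h α List.mem_cons_self]

theorem top_of_std {n : ℕ} (N : Submodule ℤ (Fin n → ℤ)) (h : ∀ i, std n i ∈ N) : N = ⊤ := by
  rw [eq_top_iff]
  intro x _
  rw [pi_eq_sum_univ' x]
  refine Submodule.sum_mem _ fun i _ => Submodule.smul_mem _ _ ?_
  convert h i using 1
  funext k
  rw [std_apply]
  simp [Pi.single_apply, eq_comm]

theorem le_k2 {n : ℕ} (l : List (Fin n → ℤ)) :
    n - l.length ≤ k2z (PhiB n) (Submodule.span ℤ {α | α ∈ l}) := by
  refine le_csInf ⟨n, std n, std_mem, ?_⟩ ?_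
  · exact top_of_std _ fun i => Submodule.mem_sup_right (Submodule.subset_span ⟨i, rfl⟩)
  · rintro k ⟨f, -, hf⟩
    by_contra hlt
    obtain ⟨x, hx0, hx⟩ := exists_orth (l ++ List.ofFn f) (by simp; omega)
    refine hx0 (orth_top x {α | α ∈ l} (Set.range f) (fun α hα => hx α (by simp_all)) ?_ ?_)
    · rintro _ ⟨j, rfl⟩
      exact hx _ (by simp [List.mem_ofFn])
    · intro i; rw [hf]; trivial

/-- For every element `w` of the Weyl group of type `B_n` one has
`k₄(L, w) = n - l(w)`; equivalently, `w` has a reduced presentation whose subroot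
lattice `L₁` is primitive, i.e. `ℤ^n / L₁` is torsion-free. -/
theorem stmt17 (n : ℕ) (hn : 2 ≤ n) (w : (Fin n → ℤ) → (Fin n → ℤ))
    (hw : ∃ l : List (Fin n → ℤ), IsPresZ (PhiB n) w l) :
    k4z (PhiB n) w = n - clen (PhiB n) w ∧
    ∃ l : List (Fin n → ℤ), IsPresZ (PhiB n) w l ∧ l.length = clen (PhiB n) w ∧
      NoZeroSMulDivisors ℤ ((Fin n → ℤ) ⧸ Submodule.span ℤ {α | α ∈ l}) := by
  obtain ⟨l₀, hl₀, hw₀⟩ := hw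
  obtain ⟨σ, ε, hε, hs⟩ := pres_signed l₀ hl₀
  obtain rfl : wSigned σ ε = w := by rw [← hs, hw₀]
  obtain ⟨l, r, hl, hr, -, horth, hlen, hspan, htf⟩ :=
    construct Finset.univ σ ε hε (by simp)
  simp only [Finset.card_univ, Fintype.card_fin] at hlen
  have hred : ∀ l', IsPresZ (PhiB n) (wSigned σ ε) l' → l.length ≤ l'.length := by
    intro l' hl'
    by_contra hlt
    obtain ⟨x, hx0, hx⟩ := exists_orth (l' ++ r) (by simp; omega)
    refine hx0 (orth_top x {α | α ∈ l} {α | α ∈ r} ?_ (fun α hα => hx α (by simp_all))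
      fun i => hspan i (Finset.mem_univ i))
    refine horth x ?_
    rw [← hl'.2]
    exact pres_fix l' x fun α hα => hx α (by simp_all)
  have hclen : clen (PhiB n) (wSigned σ ε) = l.length := by
    refine le_antisymm (Nat.sInf_le ⟨l, hl, rfl⟩) (le_csInf ⟨_, l, hl, rfl⟩ ?_)
    rintro k ⟨l', hl', rfl⟩
    exact hred l' hl'
  have hk2 : k2z (PhiB n) (Submodule.span ℤ {α | α ∈ l}) = n - l.length := by
    refine le_antisymm ?_ (le_k2 l)
    have : r.length = n - l.length := by omega
    rw [← this]
    refine Nat.sInf_le ⟨r.get, fun i => hr _ (List.get_mem _ _), ?_⟩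
    rw [Set.range_list_get]
    exact top_of_std _ fun i => hspan i (Finset.mem_univ i)
  refine ⟨?_, l, hl, hclen.symm, ?_⟩
  · refine le_antisymm (Nat.sInf_le ⟨l, hl, hclen.symm, by rw [hk2, hclen]⟩)
      (le_csInf ⟨_, l, hl, hclen.symm, rfl⟩ ?_)
    rintro c ⟨l', -, hl', rfl⟩
    rw [← hl']
    exact le_k2 l'
  · refine ⟨fun {m q} => ?_⟩
    obtain ⟨v, rfl⟩ := Submodule.Quotient.mk_surjective _ q
    intro h
    by_cases hm : m = 0
    · exact Or.inl hm
    · right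
      rw [← Submodule.Quotient.mk_smul, Submodule.Quotient.mk_eq_zero] at h
      rw [Submodule.Quotient.mk_eq_zero]
      exact htf m v hm h
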